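/- Let R be a commutative ring with distinguished elements A, Q, T such that T, 1−Q and 1−T are invertible, and assume moreover that the intersection of the ideals Q^N·R over all N ≥ 1 is zero. If p and p̃ are two row families over (R; A, Q, T) such that p_σ(v, w) = p̃_σ(v, w) whenever at least one of the strings v, w is empty, then p_σ(v, w) = p̃_σ(v, w) for all binary strings v, w with |v| = |w| = l and all σ ∈ S_l. (The row relations uniquely determine the family from its values at inputs in which one string is empty.) -/

import Mathlib

noncomputable section

/-- The cycle `X_l ∈ S_l` with (1-indexed) `X_l(1) = l` and `X_l(i) = i - 1` for
`2 ≤ i ≤ l`; in 0-indexed terms it sends `0 ↦ l-1` and `i ↦ i-1` for `1 ≤ i ≤ l-1`. -/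
def Xcycle (l : ℕ) : Equiv.Perm (Fin l) := (finRotate l)⁻¹

/-- The natural inclusion `S_l ↪ S_{l+1}` fixing the last strand `l+1`. -/
def inclPerm {l : ℕ} (σ : Equiv.Perm (Fin l)) : Equiv.Perm (Fin (l + 1)) :=
  finSuccEquivLast.permCongr.symm σ.optionCongr

/-- The map `Tr_{l+1} : S_{l+1} → S_l`, given by `Tr(σ)(i) = σ(i)` if `σ(i) ≠ l+1` and
`Tr(σ)(i) = σ(l+1)` if `σ(i) = l+1`. -/
def trPerm {l : ℕ} (σ : Equiv.Perm (Fin (l + 1))) : Equiv.Perm (Fin l) :=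
  Equiv.removeNone (finSuccEquivLast.permCongr σ)

/-- A *row family* over `(R; A, Q, T)`.  Binary strings are `List Bool`
(`true` is `1`, `false` is `0`), the number of ones of `v` is `v.count true`, and
`p l v w σ` is the value of the family at the pair `(v, w)` with `|v| = |w| = l`
and `σ ∈ S_l`.  The seven fields are the row relations (1)–(7). -/
structure RowFamily (R : Type*) [CommRing R] (A Q T : R) where
  p : (l : ℕ) → List Bool → List Bool → Equiv.Perm (Fin l) → R
  rel1 : ∀ m n : ℕ,
    p 1 (List.replicate m false ++ [true]) (List.replicate n false ++ [true]) 1 =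
      (1 + A) * Ring.inverse (1 - Q) * Ring.inverse (1 - T) *
        p 0 (List.replicate m false) (List.replicate n false) 1
  rel2 : ∀ (l : ℕ) (v w : List Bool) (σ : Equiv.Perm (Fin (l + 1))),
    1 ≤ l → v.count true = l → w.count true = l → σ (Fin.last l) = Fin.last l →
    p (l + 1) (v ++ [true]) (w ++ [true]) σ =
      (T ^ l + A) * Ring.inverse (1 - T) * p l v w (trPerm σ)
  rel3 : ∀ (l : ℕ) (v w : List Bool) (σ : Equiv.Perm (Fin (l + 1))),
    1 ≤ l → v.count true = l → w.count true = l → σ (Fin.last l) ≠ Fin.last l →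
    p (l + 1) (v ++ [true]) (w ++ [true]) σ = (T ^ l + A) * p l v w (trPerm σ)
  rel4 : ∀ (l : ℕ) (v w : List Bool) (σ : Equiv.Perm (Fin (l + 1))),
    v.count true = l + 1 → w.count true = l →
    p (l + 1) (v ++ [false]) (w ++ [true]) σ =
      p (l + 1) v (true :: w) (σ * Xcycle (l + 1))
  rel5 : ∀ (l : ℕ) (v w : List Bool) (σ : Equiv.Perm (Fin (l + 1))),
    v.count true = l → w.count true = l + 1 →
    p (l + 1) (v ++ [true]) (w ++ [false]) σ =
      p (l + 1) (true :: v) w (Xcycle (l + 1) * σ)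
  rel6 : ∀ m n : ℕ,
    p 0 (List.replicate (m + 1) false) (List.replicate (n + 1) false) 1 =
      p 1 (true :: List.replicate m false) (true :: List.replicate n false) 1
  rel7 : ∀ (l : ℕ) (v w : List Bool) (σ : Equiv.Perm (Fin (l + 1))),
    v.count true = l + 1 → w.count true = l + 1 →
    p (l + 1) (v ++ [false]) (w ++ [false]) σ =
      Ring.inverse (T ^ (l + 1)) * p (l + 2) (true :: v) (true :: w) (inclPerm σ) +
        Ring.inverse (T ^ (l + 1)) * Q * p (l + 1) (false :: v) (false :: w) σ

theorem eq_replicate_false_of_count_true_eq_zero {v : List Bool} (h : v.count true = 0) :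
    v = List.replicate v.length false :=
  List.eq_replicate_of_mem fun b hb => by
    cases b with
    | false => rfl
    | true => exact absurd hb (List.count_eq_zero.mp h)

namespace RowFamily

variable {R : Type*} [CommRing R] {A Q T : R}

/-- Two row families agree at a pair of strings not both ending in `0` as soon as they agree
at all pairs of strictly smaller total length. -/
theorem p_concat_eq_of_shorter (P P' : RowFamily R A Q T) {a b : Bool} (hab : a = true ∨ b = true)
    (v w : List Bool)
    (ih : ∀ (l : ℕ) (v' w' : List Bool) (σ : Equiv.Perm (Fin l)),
      v'.length + w'.length < (v ++ [a]).length + (w ++ [b]).length →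
      v'.count true = l → w'.count true = l → P.p l v' w' σ = P'.p l v' w' σ)
    (l : ℕ) (σ : Equiv.Perm (Fin l))
    (hv : (v ++ [a]).count true = l) (hw : (w ++ [b]).count true = l) :
    P.p l (v ++ [a]) (w ++ [b]) σ = P'.p l (v ++ [a]) (w ++ [b]) σ := by
  obtain _ | l := l
  · rcases hab with rfl | rfl <;> simp at hv hw
  cases a <;> cases b <;> simp at hab hv hw
  · rw [P.rel4 l v w σ hv hw, P'.rel4 l v w σ hv hw]
    exact ih _ _ _ _ (by simp) hv (by simp [hw])
  · rw [P.rel5 l v w σ hv hw, P'.rel5 l v w σ hv hw]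
    exact ih _ _ _ _ (by simp) (by simp [hv]) hw
  · obtain rfl | hl := Nat.eq_zero_or_pos l
    · have hσ : σ = 1 := Subsingleton.elim (α := Equiv.Perm (Fin 1)) _ _
      have hlt : v.length + w.length < (v ++ [true]).length + (w ++ [true]).length := by
        simp; omega
      have h := ih 0 v w 1 hlt hv hw
      rw [eq_replicate_false_of_count_true_eq_zero hv,
        eq_replicate_false_of_count_true_eq_zero hw] at h ⊢
      rw [hσ, P.rel1, P'.rel1, h]
    · have h := ih l v w (trPerm σ) (by simp; omega) hv hw
      by_cases hσ : σ (Fin.last l) = Fin.last l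
      · rw [P.rel2 l v w σ hl hv hw hσ, P'.rel2 l v w σ hl hv hw hσ, h]
      · rw [P.rel3 l v w σ hl hv hw hσ, P'.rel3 l v w σ hl hv hw hσ, h]

/-- If two row families are congruent modulo `q` at the pairs of strings of the same lengths,
then at a pair of strings ending in `0` they are congruent modulo `Q * q`, provided this holds
at the pairs of the same lengths whose first string has fewer zeros. -/
theorem mul_dvd_p_concat_false_sub (P P' : RowFamily R A Q T) {q : R} (v w : List Bool)
    (hq : ∀ (l : ℕ) (v' w' : List Bool) (σ : Equiv.Perm (Fin l)),
      v'.length + w'.length = (v ++ [false]).length + (w ++ [false]).length →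
      v'.count true = l → w'.count true = l → q ∣ P.p l v' w' σ - P'.p l v' w' σ)
    (ih : ∀ (l : ℕ) (v' w' : List Bool) (σ : Equiv.Perm (Fin l)),
      v'.length + w'.length = (v ++ [false]).length + (w ++ [false]).length →
      v'.count false < (v ++ [false]).count false →
      v'.count true = l → w'.count true = l → Q * q ∣ P.p l v' w' σ - P'.p l v' w' σ)
    (l : ℕ) (σ : Equiv.Perm (Fin l))
    (hv : (v ++ [false]).count true = l) (hw : (w ++ [false]).count true = l) :
    Q * q ∣ P.p l (v ++ [false]) (w ++ [false]) σ - P'.p l (v ++ [false]) (w ++ [false]) σ := by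
  simp at hv hw
  obtain _ | l := l
  · have hσ : σ = 1 := Subsingleton.elim _ _
    have h := ih 1 (true :: v) (true :: w) 1 (by simp) (by simp) (by simp [hv]) (by simp [hw])
    rw [eq_replicate_false_of_count_true_eq_zero hv,
      eq_replicate_false_of_count_true_eq_zero hw] at h ⊢
    rwa [hσ, ← List.replicate_succ', ← List.replicate_succ', P.rel6, P'.rel6]
  · rw [P.rel7 l v w σ hv hw, P'.rel7 l v w σ hv hw]
    obtain ⟨r, hr⟩ := ih (l + 2) (true :: v) (true :: w) (inclPerm σ) (by simp) (by simp)
      (by simp [hv]) (by simp [hw])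
    obtain ⟨s, hs⟩ := hq (l + 1) (false :: v) (false :: w) σ (by simp) (by simp [hv])
      (by simp [hw])
    exact ⟨Ring.inverse (T ^ (l + 1)) * (r + s), by
      linear_combination Ring.inverse (T ^ (l + 1)) * hr + Ring.inverse (T ^ (l + 1)) * Q * hs⟩

end RowFamily

/-- The row relations uniquely determine the family from its values at inputs in
which at least one of the two strings is empty. -/
theorem rowFamily_unique {R : Type*} [CommRing R] {A Q T : R}
    (hT : IsUnit T) (hQ1 : IsUnit (1 - Q)) (hT1 : IsUnit (1 - T))
    (hQadic : ∀ x : R, (∀ N : ℕ, 1 ≤ N → ∃ r : R, x = Q ^ N * r) → x = 0)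
    (P P' : RowFamily R A Q T)
    (hbase : ∀ (l : ℕ) (v w : List Bool) (σ : Equiv.Perm (Fin l)),
      v.count true = l → w.count true = l → v = [] ∨ w = [] →
      P.p l v w σ = P'.p l v w σ) :
    ∀ (l : ℕ) (v w : List Bool) (σ : Equiv.Perm (Fin l)),
      v.count true = l → w.count true = l → P.p l v w σ = P'.p l v w σ := by
  intro l v w
  induction hk : v.length + w.length using Nat.strong_induction_on generalizing l v w with
  | _ k ihk =>
  subst hk
  have hdvd : ∀ (N z l : ℕ) (v' w' : List Bool) (σ : Equiv.Perm (Fin l)),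
      v'.length + w'.length = v.length + w.length → v'.count false = z →
      v'.count true = l → w'.count true = l → Q ^ N ∣ P.p l v' w' σ - P'.p l v' w' σ := by
    intro N
    induction N with
    | zero => simp
    | succ N ihN =>
      intro z
      induction z using Nat.strong_induction_on with
      | _ z ihz =>
      intro l v' w' σ hlen hz hv hw
      obtain rfl | ⟨v', a, rfl⟩ := v'.eq_nil_or_concat'
      · simp [hbase l _ w' σ hv hw (Or.inl rfl)]
      obtain rfl | ⟨w', b, rfl⟩ := w'.eq_nil_or_concat'
      · simp [hbase l _ _ σ hv hw (Or.inr rfl)]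
      by_cases hab : a = true ∨ b = true
      · rw [P.p_concat_eq_of_shorter P' hab v' w'
          (fun l v'' w'' σ h => ihk _ (hlen ▸ h) l v'' w'' rfl σ) l σ hv hw, sub_self]
        exact dvd_zero _
      · simp only [not_or, Bool.not_eq_true] at hab
        obtain ⟨rfl, rfl⟩ := hab
        rw [pow_succ']
        refine P.mul_dvd_p_concat_false_sub P' v' w'
          (fun l v'' w'' σ h => ihN _ l v'' w'' σ (h.trans hlen) rfl)
          (fun l v'' w'' σ h hlt => ?_) l σ hv hw
        rw [← pow_succ']
        exact ihz _ (hz ▸ hlt) l v'' w'' σ (h.trans hlen) rfl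
  intro σ hv hw
  exact sub_eq_zero.mp (hQadic _ fun N _ => hdvd N _ l v w σ rfl rfl hv hw)

end
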